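/- Let n ≥ d+2 and suppose A is a generalized permutation matrix (of size N×N, where N = C(n,2)) that is a linear automorphism of M_{d,n}. Then A is a scalar multiple of the permutation matrix induced by a vertex relabeling of K_n. -/

import Mathlib

/-- Edges of the complete graph `K_n`: unordered pairs of distinct vertices.
There are `N = C(n,2)` of them, and they index the coordinates of `ℂ^N`. -/
abbrev Edge (n : ℕ) : Type := {e : Sym2 (Fin n) // ¬ e.IsDiag}

/-- Complex squared length along an edge: `m_ij(p) = Σ_k (p_i^k − p_j^k)²`
(complex squares, no conjugation). -/
noncomputable def cSqLen {n d : ℕ} (p : Fin n → Fin d → ℂ) : Sym2 (Fin n) → ℂ :=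
  Sym2.lift ⟨fun i j => ∑ k, (p i k - p j k) ^ 2,
    fun i j => Finset.sum_congr rfl fun k _ => by ring⟩

/-- The squared measurement variety `M_{d,n}`: the image of the squared
measurement map over all complex configurations of `n` points in ℂ^d. -/
def Mvar (d n : ℕ) : Set (Edge n → ℂ) :=
  {w | ∃ p : Fin n → Fin d → ℂ, ∀ e : Edge n, w e = cSqLen p e.val}

/-- The coordinate-wise squaring map `s`. -/
def sqMap {n : ℕ} (w : Edge n → ℂ) : Edge n → ℂ := fun e => w e ^ 2

/-- The unsquared measurement variety `L_{d,n} = s⁻¹(M_{d,n})`. -/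
def Lvar (d n : ℕ) : Set (Edge n → ℂ) := sqMap ⁻¹' Mvar d n


open Matrix in
lemma aux_fact {n : ℕ} (k : ℕ) : ∀ (G : Matrix (Fin n) (Fin n) ℂ), G.IsSymm → G.rank ≤ k →
    ∃ P : Fin n → Fin k → ℂ, ∀ i j, G i j = ∑ l, P i l * P j l := by
  induction k with
  | zero =>
    intro G hs hr
    have h0 : G = 0 := by
      have h1 : Module.finrank ℂ (LinearMap.range G.mulVecLin) = 0 := by
        have : G.rank = 0 := by omega
        exact this
      rw [Submodule.finrank_eq_zero, LinearMap.range_eq_bot] at h1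
      ext i j
      have h2 := congrFun (LinearMap.congr_fun h1 (Pi.single j 1)) i
      simpa using h2
    exact ⟨fun _ _ => 0, by simp [h0]⟩
  | succ k ih =>
    intro G hs hr
    by_cases hG : G = 0
    · exact ⟨fun _ _ => 0, by simp [hG]⟩
    have hx : ∃ x : Fin n → ℂ, x ⬝ᵥ (G *ᵥ x) ≠ 0 := by
      by_contra! hcon
      apply hG
      ext i j
      have h1 := hcon (Pi.single i 1)
      have h2 := hcon (Pi.single j 1)
      have h3 := hcon (Pi.single i 1 + Pi.single j 1)
      have h4 : G j i = G i j := hs.apply i j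
      simp [Matrix.mulVec_add, dotProduct_add, add_dotProduct] at h1 h2 h3
      rw [h1, h2, h4] at h3
      simp only [Matrix.zero_apply]
      linear_combination h3 / 2
    obtain ⟨x, hx⟩ := hx
    obtain ⟨s, hs2⟩ := IsAlgClosed.exists_pow_nat_eq (x ⬝ᵥ (G *ᵥ x)) (zero_lt_two)
    have hs0 : s ≠ 0 := by
      rintro rfl
      apply hx
      rw [← hs2]; simp
    set y : Fin n → ℂ := s⁻¹ • (G *ᵥ x) with hy
    have hyG : G *ᵥ x = s • y := by rw [hy, smul_smul, mul_inv_cancel₀ hs0, one_smul]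
    have hxy : x ⬝ᵥ y = s := by
      rw [hy, dotProduct_smul, ← hs2, smul_eq_mul]; field_simp
    set G' : Matrix (Fin n) (Fin n) ℂ := G - vecMulVec y y with hG'
    have hG's : G'.IsSymm := by
      ext i j
      simp [hG', vecMulVec_apply, hs.apply i j, mul_comm]
    have hmul : ∀ z, G' *ᵥ z = G *ᵥ z - (y ⬝ᵥ z) • y := by
      intro z
      rw [hG', sub_mulVec, vecMulVec_mulVec]
      ext i; simp
    have hrk : G'.rank < G.rank := by
      apply Submodule.finrank_lt_finrank_of_lt
      rw [lt_iff_le_and_ne]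
      have hyr : y ∈ LinearMap.range G.mulVecLin := ⟨s⁻¹ • x, by simp [hy]⟩
      constructor
      · rintro _ ⟨z, rfl⟩
        rw [mulVecLin_apply, hmul]
        exact Submodule.sub_mem _ ⟨z, rfl⟩ (Submodule.smul_mem _ _ hyr)
      · intro he
        rw [← he] at hyr
        obtain ⟨z, hz⟩ := hyr
        rw [mulVecLin_apply, hmul] at hz
        have h1 : x ⬝ᵥ (G *ᵥ z) = s * (y ⬝ᵥ z) := by
          rw [dotProduct_mulVec, ← mulVec_transpose, hs.eq, hyG, smul_dotProduct, smul_eq_mul]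
        have h2 := congrArg (fun v => x ⬝ᵥ v) hz
        simp only [dotProduct_sub, dotProduct_smul, hxy, h1, smul_eq_mul] at h2
        apply hs0
        rw [← h2]; ring
    obtain ⟨P, hP⟩ := ih G' hG's (by omega)
    refine ⟨fun i => Fin.cons (y i) (P i), fun i j => ?_⟩
    rw [Fin.sum_univ_succ]
    simp only [Fin.cons_zero, Fin.cons_succ, ← hP]
    simp [hG', vecMulVec_apply]

open Matrix in
lemma aux_pencil {n r : ℕ} (G H : Matrix (Fin n) (Fin n) ℂ) (hs : G.IsSymm) (hr : G.rank = r)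
    (x : Fin n → ℂ) (hx : G *ᵥ x = 0) (hp : ∀ t : ℂ, (G + t • H).rank ≤ r) :
    x ⬝ᵥ (H *ᵥ x) = 0 := by
  by_contra hc
  let b := Module.finBasisOfFinrankEq ℂ (LinearMap.range G.mulVecLin) hr
  have hy : ∀ i, ∃ y, G *ᵥ y = (b i : Fin n → ℂ) := fun i => (b i).2
  choose y hy using hy
  let f : ℂ → Fin (r + 1) → (Fin n → ℂ) := fun t =>
    Fin.cons (H *ᵥ x) (fun i => (G + t • H) *ᵥ (y i))
  have hf0 : LinearIndependent ℂ (f 0) := by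
    simp only [f]
    rw [linearIndependent_finCons]
    constructor
    · have := b.linearIndependent.map' (Submodule.subtype _) (Submodule.ker_subtype _)
      have e : (fun i => (G + (0:ℂ) • H) *ᵥ (y i)) =
          (Submodule.subtype (LinearMap.range G.mulVecLin)) ∘ b := by
        funext i
        simp [hy]
      rw [e]
      exact this
    · intro hmem
      have hle : Submodule.span ℂ (Set.range fun i => (G + (0:ℂ) • H) *ᵥ (y i)) ≤
          LinearMap.range G.mulVecLin := by
        rw [Submodule.span_le]
        rintro _ ⟨i, rfl⟩
        exact ⟨y i, by simp⟩
      obtain ⟨z, hz⟩ := hle hmem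
      apply hc
      rw [← hz, mulVecLin_apply, dotProduct_mulVec, ← mulVec_transpose, hs.eq, hx, zero_dotProduct]
  have hcont : Continuous f := by
    rw [continuous_pi_iff]
    intro i
    refine Fin.cases ?_ (fun j => ?_) i
    · simp only [f, Fin.cons_zero]; exact continuous_const
    · simp only [f, Fin.cons_succ, add_mulVec, smul_mulVec]
      fun_prop
  have hev := hcont.continuousAt.eventually (LinearIndependent.eventually hf0)
  have hev2 : ∀ᶠ t in nhdsWithin (0:ℂ) {0}ᶜ, LinearIndependent ℂ (f t) :=
    hev.filter_mono nhdsWithin_le_nhds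
  obtain ⟨t, ht, ht0⟩ := (hev2.and self_mem_nhdsWithin).exists
  have ht0 : t ≠ 0 := ht0
  have hmem : ∀ i, f t i ∈ LinearMap.range (G + t • H).mulVecLin := by
    intro i
    refine Fin.cases ?_ (fun j => ?_) i
    · refine ⟨t⁻¹ • x, ?_⟩
      simp only [f, Fin.cons_zero]
      rw [mulVecLin_apply, add_mulVec, mulVec_smul, hx, smul_mulVec, mulVec_smul, smul_smul,
        mul_inv_cancel₀ ht0]
      simp
    · exact ⟨y j, by simp only [f, Fin.cons_succ, mulVecLin_apply]⟩
  have hle : Submodule.span ℂ (Set.range (f t)) ≤ LinearMap.range (G + t • H).mulVecLin := by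
    rw [Submodule.span_le]; rintro _ ⟨i, rfl⟩; exact hmem i
  have h1 := Submodule.finrank_mono hle
  rw [finrank_span_eq_card ht] at h1
  have h2 : Module.finrank ℂ (LinearMap.range (G + t • H).mulVecLin) ≤ r := hp t
  simp at h1
  omega


def edg {n : ℕ} {i j : Fin n} (h : i ≠ j) : Edge n := ⟨s(i, j), by simpa using h⟩

lemma edg_surj {n : ℕ} (e : Edge n) : ∃ (i j : Fin n) (h : i ≠ j), e = edg h := by
  obtain ⟨e, he⟩ := e
  induction e using Sym2.ind with
  | _ i j => exact ⟨i, j, by simpa using he, rfl⟩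

lemma cSqLen_mk {n d : ℕ} (p : Fin n → Fin d → ℂ) (i j : Fin n) :
    cSqLen p s(i, j) = ∑ k, (p i k - p j k) ^ 2 := rfl

lemma mem_Mvar {n d : ℕ} (w : Edge n → ℂ) : w ∈ Mvar d n ↔ ∃ p : Fin n → Fin d → ℂ,
    ∀ (i j : Fin n) (h : i ≠ j), w (edg h) = ∑ k, (p i k - p j k) ^ 2 := by
  constructor
  · rintro ⟨p, hp⟩
    exact ⟨p, fun i j h => hp _⟩
  · rintro ⟨p, hp⟩
    refine ⟨p, fun e => ?_⟩
    obtain ⟨i, j, h, rfl⟩ := edg_surj e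
    exact hp i j h

/-- Extension of an edge vector to all ordered pairs. -/
def Wex {n : ℕ} (w : Edge n → ℂ) (i j : Fin n) : ℂ := if h : i = j then 0 else w (edg h)

lemma edg_comm {n : ℕ} {i j : Fin n} (h : i ≠ j) : edg h = edg h.symm := by
  apply Subtype.ext; exact Sym2.eq_swap

lemma Wex_comm {n : ℕ} (w : Edge n → ℂ) (i j : Fin n) : Wex w i j = Wex w j i := by
  unfold Wex
  by_cases h : i = j
  · subst h; rfl
  · rw [dif_neg h, dif_neg (Ne.symm h), edg_comm h]

lemma Wex_self {n : ℕ} (w : Edge n → ℂ) (i : Fin n) : Wex w i i = 0 := by simp [Wex]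

lemma Wex_add {n : ℕ} (w u : Edge n → ℂ) (t : ℂ) (i j : Fin n) :
    Wex (w + t • u) i j = Wex w i j + t * Wex u i j := by
  unfold Wex; split_ifs <;> simp

/-- Gram matrix with base point `b`. -/
noncomputable def Gm {n : ℕ} (b : Fin n) (w : Edge n → ℂ) : Matrix (Fin n) (Fin n) ℂ :=
  Matrix.of fun i j => (Wex w b i + Wex w b j - Wex w i j) / 2

lemma Gm_symm {n : ℕ} (b : Fin n) (w : Edge n → ℂ) : (Gm b w).IsSymm := by
  ext i j
  simp only [Gm, Matrix.transpose_apply, Matrix.of_apply, Wex_comm w i j]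
  ring

lemma Gm_add {n : ℕ} (b : Fin n) (w u : Edge n → ℂ) (t : ℂ) :
    Gm b (w + t • u) = Gm b w + t • Gm b u := by
  ext i j
  simp only [Gm, Matrix.of_apply, Wex_add, Matrix.add_apply, Matrix.smul_apply, smul_eq_mul]
  ring

lemma mem_iff_rank {n d : ℕ} (b : Fin n) (w : Edge n → ℂ) :
    w ∈ Mvar d n ↔ (Gm b w).rank ≤ d := by
  rw [mem_Mvar]
  constructor
  · rintro ⟨p, hp⟩
    have hW : ∀ i j, Wex w i j = ∑ k, (p i k - p j k) ^ 2 := by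
      intro i j
      by_cases h : i = j
      · subst h; simp [Wex]
      · rw [Wex, dif_neg h, hp]
    have hG : Gm b w = (Matrix.of fun i (k : Fin d) => p i k - p b k) *
        (Matrix.of fun (k : Fin d) i => p i k - p b k) := by
      ext i j
      simp only [Gm, Matrix.of_apply, hW, Matrix.mul_apply]
      rw [← Finset.sum_add_distrib, ← Finset.sum_sub_distrib, Finset.sum_div]
      exact Finset.sum_congr rfl fun k _ => by ring
    rw [hG]
    exact (Matrix.rank_mul_le_left _ _).trans (Matrix.rank_le_width _)
  · intro h
    obtain ⟨P, hP⟩ := aux_fact d _ (Gm_symm b w) h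
    refine ⟨P, fun i j hij => ?_⟩
    have h1 : ∑ k, (P i k - P j k) ^ 2 = Gm b w i i + Gm b w j j - 2 * Gm b w i j := by
      rw [hP, hP, hP, ← Finset.sum_add_distrib, Finset.mul_sum, ← Finset.sum_sub_distrib]
      exact Finset.sum_congr rfl fun k _ => by ring
    rw [h1]
    simp only [Gm, Matrix.of_apply, Wex_self]
    have : w (edg hij) = Wex w i j := by rw [Wex, dif_neg hij]
    rw [this]; ring

/-- The one-dimensional measurement vector. -/
def m1 {n : ℕ} (a : Fin n → ℂ) : Edge n → ℂ := fun e =>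
  Sym2.lift ⟨fun i j => (a i - a j) ^ 2, fun i j => by ring⟩ e.val

lemma m1_edg {n : ℕ} (a : Fin n → ℂ) {i j : Fin n} (h : i ≠ j) :
    m1 a (edg h) = (a i - a j) ^ 2 := rfl

lemma mem_M1 {n : ℕ} (w : Edge n → ℂ) : w ∈ Mvar 1 n ↔ ∃ a, w = m1 a := by
  rw [mem_Mvar]
  constructor
  · rintro ⟨p, hp⟩
    refine ⟨fun i => p i 0, ?_⟩
    ext e
    obtain ⟨i, j, h, rfl⟩ := edg_surj e
    rw [hp, m1_edg]; simp
  · rintro ⟨a, rfl⟩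
    exact ⟨fun i _ => a i, fun i j h => by simp [m1_edg]⟩

lemma mem_add_m1 {n d : ℕ} {w : Edge n → ℂ} (hw : w ∈ Mvar d n) (a : Fin n → ℂ) (t : ℂ) :
    w + t • m1 a ∈ Mvar (d + 1) n := by
  rw [mem_Mvar] at hw ⊢
  obtain ⟨p, hp⟩ := hw
  obtain ⟨s, hs⟩ := IsAlgClosed.exists_pow_nat_eq t (zero_lt_two)
  refine ⟨fun i => Fin.cons (s * a i) (p i), fun i j h => ?_⟩
  rw [Fin.sum_univ_succ]
  simp only [Fin.cons_zero, Fin.cons_succ, Pi.add_apply, Pi.smul_apply, smul_eq_mul, hp, m1_edg]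
  rw [← hs]; ring

lemma Mvar_mono {n d : ℕ} {w : Edge n → ℂ} (hw : w ∈ Mvar d n) : w ∈ Mvar (d + 1) n := by
  simpa using mem_add_m1 hw 0 0

lemma span_m1 {n : ℕ} : Submodule.span ℂ (Set.range (m1 (n := n))) = ⊤ := by
  rw [eq_top_iff, ← (Pi.basisFun ℂ (Edge n)).span_eq, Submodule.span_le]
  rintro _ ⟨e, rfl⟩
  obtain ⟨i, j, h, rfl⟩ := edg_surj e
  have key : (Pi.basisFun ℂ (Edge n)) (edg h) = (2⁻¹ : ℂ) • (m1 (Pi.single i 1) +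
      m1 (Pi.single j 1) - m1 (Pi.single i 1 + Pi.single j 1)) := by
    ext e
    obtain ⟨x, y, hxy, rfl⟩ := edg_surj e
    simp only [Pi.basisFun_apply, Pi.smul_apply, Pi.add_apply, Pi.sub_apply, m1_edg,
      Pi.single_apply, smul_eq_mul]
    have : (edg hxy = edg h) ↔ (x = i ∧ y = j ∨ x = j ∧ y = i) := by
      rw [Subtype.ext_iff]; exact Sym2.eq_iff
    rw [if_congr this rfl rfl]
    clear this
    by_cases h1 : x = i <;> by_cases h2 : x = j <;> by_cases h3 : y = i <;> by_cases h4 : y = j <;>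
      simp_all <;> norm_num
  rw [key]
  have hm : ∀ a, m1 a ∈ Submodule.span ℂ (Set.range (m1 (n := n))) :=
    fun a => Submodule.subset_span ⟨a, rfl⟩
  exact Submodule.smul_mem _ _ (Submodule.sub_mem _ (Submodule.add_mem _ (hm _) (hm _)) (hm _))

def Uset {n : ℕ} (d : ℕ) (w : Edge n → ℂ) : Set (Edge n → ℂ) :=
  {u | ∀ t : ℂ, w + t • u ∈ Mvar d n}

open Matrix in
lemma char_M {n d : ℕ} (hn : d + 3 ≤ n) (w : Edge n → ℂ) :
    w ∈ Mvar d n ↔ w ∈ Mvar (d + 1) n ∧ Submodule.span ℂ (Uset (d + 1) w) = ⊤ := by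
  constructor
  · intro h
    refine ⟨Mvar_mono h, ?_⟩
    rw [eq_top_iff, ← span_m1]
    apply Submodule.span_mono
    rintro _ ⟨a, rfl⟩ t
    exact mem_add_m1 h a t
  · rintro ⟨hw, hsp⟩
    let b : Fin n := ⟨0, by omega⟩
    rw [mem_iff_rank b] at hw ⊢
    by_contra hcon
    have hr : (Gm b w).rank = d + 1 := by omega
    -- kernel vector with a nonzero coordinate off b
    obtain ⟨x, hx, i, hib, hxi⟩ : ∃ x, (Gm b w) *ᵥ x = 0 ∧ ∃ i, i ≠ b ∧ x i ≠ 0 := by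
      by_contra! hno
      have hle : LinearMap.ker (Gm b w).mulVecLin ≤ Submodule.span ℂ {Pi.single b (1:ℂ)} := by
        intro x hx
        rw [Submodule.mem_span_singleton]
        refine ⟨x b, ?_⟩
        ext i
        by_cases hi : i = b
        · subst hi; simp
        · simp [hi, hno x hx i hi]
      have h1 := Submodule.finrank_mono hle
      have h2 : Module.finrank ℂ (Submodule.span ℂ {(Pi.single b (1:ℂ) : Fin n → ℂ)}) = 1 :=
        finrank_span_singleton (by simp)
      have h3 := LinearMap.finrank_range_add_finrank_ker (Gm b w).mulVecLin
      have h4 : Module.finrank ℂ (LinearMap.range (Gm b w).mulVecLin) = d + 1 := hr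
      simp at h3
      omega
    let φ : (Edge n → ℂ) →ₗ[ℂ] ℂ :=
      { toFun := fun u => x ⬝ᵥ (Gm b u *ᵥ x)
        map_add' := fun u v => by
          have := Gm_add b u v 1
          rw [one_smul, one_smul] at this
          rw [this, add_mulVec, dotProduct_add]
        map_smul' := fun t u => by
          have := Gm_add b 0 u t
          have h0 : Gm b (0 : Edge n → ℂ) = 0 := by
            ext i j; simp [Gm, Wex]
          rw [zero_add, h0, zero_add] at this
          simp only [this, smul_mulVec, dotProduct_smul, RingHom.id_apply] }
    have hφ : Submodule.span ℂ (Uset (d + 1) w) ≤ LinearMap.ker φ := by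
      rw [Submodule.span_le]
      intro u hu
      refine aux_pencil (Gm b w) (Gm b u) (Gm_symm b w) hr x hx (fun t => ?_)
      rw [← Gm_add, ← mem_iff_rank]
      exact hu t
    rw [hsp] at hφ
    have h1 : φ (m1 (Pi.single i 1)) = 0 := hφ (Submodule.mem_top)
    have h2 : Gm b (m1 (Pi.single i 1)) = vecMulVec (Pi.single i 1) (Pi.single i 1) := by
      have hW : ∀ k l, Wex (m1 (Pi.single i 1)) k l =
        ((Pi.single i 1 : Fin n → ℂ) k - (Pi.single i 1 : Fin n → ℂ) l) ^ 2 := by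
        intro k l
        by_cases hkl : k = l
        · subst hkl; simp [Wex]
        · rw [Wex, dif_neg hkl, m1_edg]
      ext k l
      simp only [Gm, of_apply, hW, vecMulVec_apply]
      rw [Pi.single_eq_of_ne (Ne.symm hib)]
      ring
    have h3 : φ (m1 (Pi.single i 1)) = x i * x i := by
      change x ⬝ᵥ (Gm b _ *ᵥ x) = _
      rw [h2, vecMulVec_mulVec]
      simp
    rw [h3] at h1
    exact hxi (by simpa using h1)

lemma descend {n d : ℕ} (hn : d + 3 ≤ n) (Φ : (Edge n → ℂ) ≃ₗ[ℂ] (Edge n → ℂ))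
    (h : ∀ w, Φ w ∈ Mvar (d + 1) n ↔ w ∈ Mvar (d + 1) n) (w : Edge n → ℂ) :
    Φ w ∈ Mvar d n ↔ w ∈ Mvar d n := by
  rw [char_M hn, char_M hn w, h]
  have hU : Uset (d + 1) (Φ w) = Φ '' Uset (d + 1) w := by
    ext u
    constructor
    · intro hu
      refine ⟨Φ.symm u, fun t => ?_, by simp⟩
      rw [← h]
      simpa using hu t
    · rintro ⟨v, hv, rfl⟩ t
      have := (h _).2 (hv t)
      simpa using this
  have : Submodule.span ℂ (Φ '' Uset (d + 1) w) =
      (Submodule.span ℂ (Uset (d + 1) w)).map Φ.toLinearMap := by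
    rw [Submodule.map_span]; rfl
  rw [hU, this]
  refine and_congr Iff.rfl ?_
  constructor
  · intro ht
    rw [eq_top_iff]
    intro x _
    have hx : Φ x ∈ (Submodule.span ℂ (Uset (d + 1) w)).map Φ.toLinearMap := by rw [ht]; trivial
    obtain ⟨y, hy, hxy⟩ := hx
    have : y = x := Φ.injective hxy
    rwa [← this]
  · intro ht
    rw [ht, Submodule.map_top, LinearMap.range_eq_top]
    exact Φ.surjective

lemma descend_one {n : ℕ} (Φ : (Edge n → ℂ) ≃ₗ[ℂ] (Edge n → ℂ)) (d : ℕ) : d + 3 ≤ n →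
    (∀ w, Φ w ∈ Mvar (d + 1) n ↔ w ∈ Mvar (d + 1) n) →
    ∀ w, Φ w ∈ Mvar 1 n ↔ w ∈ Mvar 1 n := by
  induction d with
  | zero => intro _ h; exact h
  | succ d ih =>
    intro hn h
    exact ih (by omega) (descend hn Φ h)

def Tri {n : ℕ} (e f h : Edge n) : Prop :=
  e ≠ f ∧ h ≠ e ∧ h ≠ f ∧ ∀ a, m1 a e = 0 → m1 a f = 0 → m1 a h = 0

lemma edg_eq_iff {n : ℕ} {i j k l : Fin n} (h : i ≠ j) (h' : k ≠ l) :
    edg h = edg h' ↔ (i = k ∧ j = l ∨ i = l ∧ j = k) := by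
  rw [Subtype.ext_iff]; exact Sym2.eq_iff

lemma mem_edg {n : ℕ} {i j v : Fin n} (h : i ≠ j) : v ∈ (edg h).1 ↔ v = i ∨ v = j :=
  Sym2.mem_iff

lemma m1_zero {n : ℕ} (a : Fin n → ℂ) {i j : Fin n} (h : i ≠ j) :
    m1 a (edg h) = 0 ↔ a i = a j := by
  rw [m1_edg, sq_eq_zero_iff, sub_eq_zero]

lemma Tri_mk {n : ℕ} {i j l : Fin n} (hij : i ≠ j) (hjl : j ≠ l) (hil : i ≠ l) :
    Tri (edg hij) (edg hjl) (edg hil) := by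
  refine ⟨?_, ?_, ?_, ?_⟩
  · rw [Ne, edg_eq_iff]; grind
  · rw [Ne, edg_eq_iff]; grind
  · rw [Ne, edg_eq_iff]; grind
  · intro a
    simp only [m1_zero]
    exact fun h1 h2 => h1.trans h2

lemma Tri_adj {n : ℕ} {i j l k : Fin n} (hij : i ≠ j) (hjl : j ≠ l) {h : Edge n}
    (hT : Tri (edg hij) (edg hjl) h) : ∃ hil : i ≠ l, h = edg hil := by
  obtain ⟨x, y, hxy, rfl⟩ := edg_surj h
  obtain ⟨h1, h2, h3, h4⟩ := hT
  simp only [m1_zero] at h4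
  rw [Ne, edg_eq_iff] at h1 h2 h3
  have hil : i ≠ l := by grind
  refine ⟨hil, ?_⟩
  rw [edg_eq_iff]
  have t1 := h4 (fun v => if v = i ∨ v = j ∨ v = l then 1 else 0) (by simp) (by simp)
  by_cases hx : x = i ∨ x = j ∨ x = l
  · have hy : y = i ∨ y = j ∨ y = l := by
      by_contra hy
      simp [hx, hy] at t1
    grind
  · exfalso
    have t2 := h4 (fun v => if v = x then 1 else 0) (by grind) (by grind)
    simp [hxy.symm] at t2

lemma Tri_out {n : ℕ} {e f h : Edge n} (hT : Tri e f h) :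
    ∃ (i j l : Fin n) (hij : i ≠ j) (hjl : j ≠ l) (hil : i ≠ l),
      e = edg hij ∧ f = edg hjl ∧ h = edg hil := by
  obtain ⟨i, j, hij, rfl⟩ := edg_surj e
  obtain ⟨k, l, hkl, rfl⟩ := edg_surj f
  by_cases c1 : j = k
  · subst c1
    obtain ⟨hil, rfl⟩ := Tri_adj (k := i) hij hkl hT
    exact ⟨i, j, l, hij, hkl, hil, rfl, rfl, rfl⟩
  by_cases c2 : j = l
  · subst c2
    rw [edg_comm hkl] at hT ⊢
    obtain ⟨hil, rfl⟩ := Tri_adj (k := i) hij hkl.symm hT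
    exact ⟨i, j, k, hij, hkl.symm, hil, rfl, rfl, rfl⟩
  by_cases c3 : i = k
  · subst c3
    rw [edg_comm hij] at hT ⊢
    obtain ⟨hil, rfl⟩ := Tri_adj (k := i) hij.symm hkl hT
    exact ⟨j, i, l, hij.symm, hkl, hil, rfl, rfl, rfl⟩
  by_cases c4 : i = l
  · subst c4
    rw [edg_comm hij, edg_comm hkl] at hT ⊢
    obtain ⟨hil, rfl⟩ := Tri_adj (k := i) hij.symm hkl.symm hT
    exact ⟨j, i, k, hij.symm, hkl.symm, hil, rfl, rfl, rfl⟩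
  exfalso
  obtain ⟨x, y, hxy, rfl⟩ := edg_surj h
  obtain ⟨h1, h2, h3, h4⟩ := hT
  simp only [m1_zero] at h4
  rw [Ne, edg_eq_iff] at h1 h2 h3
  have t1 := h4 (fun v => if v = i ∨ v = j then 1 else 0) (by simp) (by
    simp [Ne.symm c1, Ne.symm c2, Ne.symm c3, Ne.symm c4])
  have t2 := h4 (fun v => if v = k ∨ v = l then 1 else 0) (by simp [c1, c2, c3, c4]) (by simp)
  by_cases hx : x = i ∨ x = j
  · have hy : y = i ∨ y = j := by
      by_contra hy
      simp [hx, hy] at t1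
    grind
  by_cases hx' : x = k ∨ x = l
  · have hy : y = k ∨ y = l := by
      by_contra hy
      simp [hx', hy] at t2
    grind
  have t3 := h4 (fun v => if v = x then 1 else 0) (by grind) (by grind)
  simp [hxy.symm] at t3

lemma Tri_share {n : ℕ} {e f h : Edge n} (hT : Tri e f h) : ∃ j, j ∈ e.1 ∧ j ∈ f.1 := by
  obtain ⟨i, j, l, hij, hjl, hil, rfl, rfl, rfl⟩ := Tri_out hT
  exact ⟨j, by simp [mem_edg], by simp [mem_edg]⟩

lemma edge_other {n : ℕ} {e : Edge n} {v : Fin n} (h : v ∈ e.1) :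
    ∃ (c : Fin n) (hc : v ≠ c), e = edg hc := by
  obtain ⟨i, j, hij, rfl⟩ := edg_surj e
  rw [mem_edg] at h
  rcases h with rfl | rfl
  · exact ⟨j, hij, rfl⟩
  · exact ⟨i, hij.symm, edg_comm hij⟩

lemma eq_edg_of_mem {n : ℕ} {e : Edge n} {i l : Fin n} (hil : i ≠ l) (h1 : i ∈ e.1)
    (h2 : l ∈ e.1) : e = edg hil := by
  obtain ⟨x, y, hxy, rfl⟩ := edg_surj e
  rw [mem_edg] at h1 h2
  rw [edg_eq_iff]; grind

lemma exists_third {n : ℕ} (hn : 3 ≤ n) (v w : Fin n) : ∃ x, x ≠ v ∧ x ≠ w := by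
  have : ∃ x, x ∉ ({v, w} : Finset (Fin n)) := by
    by_contra! hc
    have h1 : (Finset.univ : Finset (Fin n)) ⊆ {v, w} := fun x _ => hc x
    have h2 := Finset.card_le_card h1
    have h3 := Finset.card_le_two (a := v) (b := w)
    simp at h2
    omega
  simpa using this

lemma star_lemma {n : ℕ} (hn : 3 ≤ n) (g : Equiv.Perm (Edge n))
    (hg : ∀ e f h, Tri e f h → Tri (g e) (g f) (g h)) (v : Fin n) :
    ∃ u : Fin n, ∀ e : Edge n, v ∈ e.1 → u ∈ (g e).1 := by
  obtain ⟨a, hav, -⟩ := exists_third hn v v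
  obtain ⟨b, hbv, hba⟩ := exists_third hn v a
  obtain ⟨i, j, l, hij, hjl, hil, h1, h2, h3⟩ :=
    Tri_out (hg _ _ _ (Tri_mk hav hbv.symm hba.symm))
  refine ⟨j, fun e he => ?_⟩
  obtain ⟨c, hc, rfl⟩ := edge_other he
  by_cases hca : c = a
  · subst hca
    rw [edg_comm hc, h1, mem_edg]; simp
  by_cases hcb : c = b
  · subst hcb
    rw [h2, mem_edg]; simp
  by_contra hj
  obtain ⟨x, hx1, hx2⟩ := Tri_share (hg _ _ _ (Tri_mk hav hc (Ne.symm hca)))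
  obtain ⟨y, hy1, hy2⟩ := Tri_share (hg _ _ _ (Tri_mk hbv hc (Ne.symm hcb)))
  rw [h1, mem_edg] at hx1
  rw [edg_comm hbv, h2, mem_edg] at hy1
  have hi : i ∈ (g (edg hc)).1 := by
    rcases hx1 with rfl | rfl
    · exact hx2
    · exact absurd hx2 hj
  have hl : l ∈ (g (edg hc)).1 := by
    rcases hy1 with rfl | rfl
    · exact absurd hy2 hj
    · exact hy2
  have h4 := eq_edg_of_mem hil hi hl
  rw [← h3] at h4
  have h5 := g.injective h4
  rw [edg_eq_iff] at h5
  grind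

lemma vertex_perm {n : ℕ} (hn : 3 ≤ n) (g : Equiv.Perm (Edge n))
    (hg : ∀ e f h, Tri e f h → Tri (g e) (g f) (g h)) :
    ∃ σ : Equiv.Perm (Fin n), ∀ (i j : Fin n) (h : i ≠ j),
      g (edg h) = edg (σ.injective.ne h) := by
  choose σ hσ using star_lemma hn g hg
  have hinj : Function.Injective σ := by
    intro v w hvw
    by_contra hne
    obtain ⟨x, hxv, hxw⟩ := exists_third hn v w
    obtain ⟨i, j, l, hij, hjl, hil, h1, h2, h3⟩ :=
      Tri_out (hg _ _ _ (Tri_mk (Ne.symm hxv) hxw hne))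
    have m1 := hσ v (edg (Ne.symm hxv)) (by simp [mem_edg])
    have m2 := hσ w (edg hxw) (by simp [mem_edg])
    have m3 := hσ v (edg hne) (by simp [mem_edg])
    rw [h1, mem_edg] at m1
    rw [h2, mem_edg] at m2
    rw [h3, mem_edg] at m3
    grind
  refine ⟨Equiv.ofBijective σ (Finite.injective_iff_bijective.1 hinj), fun i j h => ?_⟩
  apply eq_edg_of_mem
  · exact hσ i _ (by simp [mem_edg])
  · exact hσ j _ (by simp [mem_edg])

/-- Let `n ≥ d+2` and suppose `A` is a generalized permutation
matrix (exactly one non-zero entry in each row and each column) that is a linear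
automorphism of `M_{d,n}`, i.e. a non-singular linear map on `ℂ^N` mapping
`M_{d,n}` bijectively to itself.  Then `A` is a scalar multiple of the
permutation matrix induced by a vertex relabeling of `K_n`:  there are a
permutation `σ` of the vertices and a scalar `c ≠ 0` with
`A e f = c` when `e = Sym2.map σ f` and `A e f = 0` otherwise. -/
theorem generalized_permutation_automorphism_of_M_is_vertex_relabeling
    {d n : ℕ} (hd : 1 ≤ d) (hn : d + 2 ≤ n)
    (A : Matrix (Edge n) (Edge n) ℂ)
    (hgen : ∃ (g : Equiv.Perm (Edge n)) (dvec : Edge n → ℂ),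
      (∀ e, dvec e ≠ 0) ∧ ∀ e f : Edge n, A e f = if e = g f then dvec e else 0)
    (hunit : IsUnit A.det)
    (haut : (fun x => A.mulVec x) '' Mvar d n = Mvar d n) :
    ∃ (c : ℂ) (σ : Equiv.Perm (Fin n)), c ≠ 0 ∧
      ∀ e f : Edge n, A e f =
        if (e : Sym2 (Fin n)) = Sym2.map σ (f : Sym2 (Fin n)) then c else 0 := by
  classical
  obtain ⟨g, D, hD, hA⟩ := hgen
  have hn3 : 3 ≤ n := by omega
  have hAmul : ∀ (w : Edge n → ℂ) (e : Edge n), (A.mulVec w) (g e) = D (g e) * w e := by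
    intro w e
    simp only [Matrix.mulVec, dotProduct, hA, g.injective.eq_iff]
    simp
  let Φ : (Edge n → ℂ) ≃ₗ[ℂ] (Edge n → ℂ) := Matrix.toLinearEquiv' A
    ((Matrix.isUnit_iff_isUnit_det A).2 hunit).invertible
  have hΦ : ∀ w, Φ w = A.mulVec w := fun w => rfl
  have hM : ∀ w, Φ w ∈ Mvar d n ↔ w ∈ Mvar d n := by
    intro w
    constructor
    · intro h
      rw [← haut] at h
      obtain ⟨x, hx, hxw⟩ := h
      have : x = w := Φ.injective hxw
      rwa [← this]
    · intro h
      rw [← haut]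
      exact ⟨w, h, rfl⟩
  obtain ⟨d, rfl⟩ : ∃ d', d = d' + 1 := ⟨d - 1, by omega⟩
  have hM1 := descend_one Φ d (by omega) hM
  have hfw : ∀ a : Fin n → ℂ, ∃ a' : Fin n → ℂ, ∀ e, m1 a' (g e) = D (g e) * m1 a e := by
    intro a
    obtain ⟨a', ha'⟩ := (mem_M1 _).1 ((hM1 (m1 a)).2 ((mem_M1 _).2 ⟨a, rfl⟩))
    exact ⟨a', fun e => by rw [← ha', hΦ, hAmul]⟩
  have hbw : ∀ a' : Fin n → ℂ, ∃ a : Fin n → ℂ, ∀ e, m1 a' (g e) = D (g e) * m1 a e := by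
    intro a'
    have h1 : Φ.symm (m1 a') ∈ Mvar 1 n := by
      rw [← hM1, LinearEquiv.apply_symm_apply]
      exact (mem_M1 _).2 ⟨a', rfl⟩
    obtain ⟨a, ha⟩ := (mem_M1 _).1 h1
    refine ⟨a, fun e => ?_⟩
    rw [← ha, ← hAmul, ← hΦ, LinearEquiv.apply_symm_apply]
  have hT : ∀ e f h, Tri e f h → Tri (g e) (g f) (g h) := by
    rintro e f h ⟨h1, h2, h3, h4⟩
    refine ⟨g.injective.ne h1, g.injective.ne h2, g.injective.ne h3, fun a' => ?_⟩
    obtain ⟨a, ha⟩ := hbw a'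
    simp only [ha, mul_eq_zero, hD, false_or]
    exact h4 a
  obtain ⟨σ, hσ⟩ := vertex_perm hn3 g hT
  have hadj : ∀ (i j k : Fin n) (hij : i ≠ j) (hjk : j ≠ k),
      D (g (edg hij)) = D (g (edg hjk)) := by
    intro i j k hij hjk
    by_cases hik : i = k
    · subst hik; rw [edg_comm hij]
    obtain ⟨a', ha'⟩ := hfw (Pi.single j 1)
    have e1 := ha' (edg hij)
    have e2 := ha' (edg hjk)
    have e3 := ha' (edg hik)
    rw [m1_edg (Pi.single j 1), hσ, m1_edg, Pi.single_eq_same, Pi.single_eq_of_ne hij] at e1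
    rw [m1_edg (Pi.single j 1), hσ, m1_edg, Pi.single_eq_same, Pi.single_eq_of_ne hjk.symm] at e2
    rw [m1_edg (Pi.single j 1), hσ, m1_edg, Pi.single_eq_of_ne hij,
      Pi.single_eq_of_ne hjk.symm] at e3
    have e4 : a' (σ i) = a' (σ k) := by
      have : (a' (σ i) - a' (σ k)) ^ 2 = 0 := by rw [e3]; ring
      exact sub_eq_zero.1 (by simpa using this)
    rw [hσ, hσ]
    rw [e4] at e1
    linear_combination e2 - e1
  have hall : ∀ e f : Edge n, D (g e) = D (g f) := by
    intro e f
    obtain ⟨i, j, hij, rfl⟩ := edg_surj e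
    obtain ⟨k, l, hkl, rfl⟩ := edg_surj f
    by_cases hjk : j = k
    · subst hjk; exact hadj _ _ _ _ _
    · rw [hadj i j k hij hjk, hadj j k l hjk hkl]
  have h01 : (⟨0, by omega⟩ : Fin n) ≠ ⟨1, by omega⟩ := by simp
  refine ⟨D (g (edg h01)), σ, hD _, fun e f => ?_⟩
  have hiff : e = g f ↔ (e : Sym2 (Fin n)) = Sym2.map σ (f : Sym2 (Fin n)) := by
    obtain ⟨i, j, hij, rfl⟩ := edg_surj f
    rw [hσ, Subtype.ext_iff]
    rfl
  rw [hA]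
  by_cases h : e = g f
  · rw [if_pos h, if_pos (hiff.1 h), h, hall]
  · rw [if_neg h, if_neg (fun h' => h (hiff.2 h'))]
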